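/- arXiv:1203.0491 — 6 statements merged into one kernel-verified Lean document; each statement's English description precedes it below -/
import Mathlib

section
/- Let F be a field, ≺ a monomial ordering on F[X_1, …, X_m], and I ⊆ F[X_1, …, X_m] an ideal. Then the set of cosets {M + I : M ∈ Δ_≺(I)} is a basis for the quotient F[X_1, …, X_m]/I as a vector space over F. -/
/-- The leading exponent (exponent of the leading monomial) of a multivariate polynomial
with respect to a monomial order. -/
noncomputable def leadingExponent {σ F : Type*} [CommSemiring F] (m : MonomialOrder σ)
    (f : MvPolynomial σ F) : σ →₀ ℕ :=
  m.toSyn.symm (f.support.sup fun d => m.toSyn d)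

/-- The footprint `Δ_≺(I)` of an ideal `I`: the set of monomials (identified with their
exponent vectors) which are not the leading monomial of any nonzero polynomial in `I`. -/
def footprint {σ F : Type*} [CommSemiring F] (m : MonomialOrder σ)
    (I : Ideal (MvPolynomial σ F)) : Set (σ →₀ ℕ) :=
  {d | ∀ f ∈ I, f ≠ 0 → leadingExponent m f ≠ d}

theorem leadingExponent_eq_degree {σ F : Type*} [CommSemiring F] (m : MonomialOrder σ)
    (f : MvPolynomial σ F) : leadingExponent m f = m.degree f := rfl

/-- A polynomial of an ideal whose monomials all lie in the footprint vanishes. -/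
theorem eq_zero_of_mem_of_support_subset_footprint {σ F : Type*} [CommSemiring F]
    {m : MonomialOrder σ} {I : Ideal (MvPolynomial σ F)} {f : MvPolynomial σ F}
    (hf : f ∈ I) (hs : (f.support : Set (σ →₀ ℕ)) ⊆ footprint m I) : f = 0 := by
  by_contra h0
  exact hs (m.degree_mem_support h0) f hf h0 (leadingExponent_eq_degree m f)

theorem linearIndependent_mk_monomial_footprint {σ F : Type*} [Field F] (m : MonomialOrder σ)
    (I : Ideal (MvPolynomial σ F)) :
    LinearIndependent F (fun d : footprint m I =>
      Ideal.Quotient.mk I (MvPolynomial.monomial d.1 (1 : F))) := by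
  have hv : LinearIndependent F (fun d : footprint m I => MvPolynomial.monomial d.1 (1 : F)) := by
    simpa [Function.comp_def] using
      (MvPolynomial.basisMonomials σ F).linearIndependent.comp _ Subtype.val_injective
  refine hv.map (f := (Ideal.Quotient.mkₐ F I).toLinearMap) ?_
  rw [Submodule.disjoint_def]
  intro f hspan hker
  refine eq_zero_of_mem_of_support_subset_footprint (m := m) (I := I)
    (Ideal.Quotient.eq_zero_iff_mem.mp hker) ?_
  rw [← MvPolynomial.mem_restrictSupport_iff (R := F), MvPolynomial.restrictSupport_eq_span,
    Set.image_eq_range]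
  exact hspan

/-- Every monomial is congruent modulo `I` to a linear combination of footprint monomials. -/
theorem mk_monomial_mem_span_footprint {σ F : Type*} [Field F] (m : MonomialOrder σ)
    (I : Ideal (MvPolynomial σ F)) (d : σ →₀ ℕ) (c : F) :
    Ideal.Quotient.mk I (MvPolynomial.monomial d c) ∈
      Submodule.span F (Set.range fun d : footprint m I =>
        Ideal.Quotient.mk I (MvPolynomial.monomial d.1 (1 : F))) := by
  classical
  set S := Submodule.span F (Set.range fun d : footprint m I =>
    Ideal.Quotient.mk I (MvPolynomial.monomial d.1 (1 : F)))
  induction h : m.toSyn d using WellFoundedLT.induction generalizing d c with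
  | ind x ih =>
    subst h
    by_cases hd : d ∈ footprint m I
    · have hc : Ideal.Quotient.mk I (MvPolynomial.monomial d c) =
          c • Ideal.Quotient.mk I (MvPolynomial.monomial d (1 : F)) := by
        rw [← Ideal.Quotient.mkₐ_eq_mk F, ← map_smul, MvPolynomial.smul_monomial, smul_eq_mul,
          mul_one]
      rw [hc]
      exact S.smul_mem c (Submodule.subset_span ⟨⟨d, hd⟩, rfl⟩)
    · simp only [footprint, Set.mem_ofPred_eq, not_forall, not_not] at hd
      obtain ⟨f, hfI, hf0, rfl⟩ := hd
      rw [leadingExponent_eq_degree] at ih ⊢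
      have hlc : m.leadingCoeff f ≠ 0 := m.leadingCoeff_ne_zero_iff.mpr hf0
      set a : F := c * (m.leadingCoeff f)⁻¹ with ha
      set g := MvPolynomial.monomial (m.degree f) c - MvPolynomial.C a * f with hg
      have hmk : Ideal.Quotient.mk I (MvPolynomial.monomial (m.degree f) c) =
          Ideal.Quotient.mk I g := by
        rw [Ideal.Quotient.eq, hg, sub_sub_cancel]
        exact I.mul_mem_left _ hfI
      rw [hmk, g.as_sum, map_sum]
      refine S.sum_mem fun e he => ih (m.toSyn e) ?_ e _ rfl
      have hcoeff := MvPolynomial.mem_support_iff.mp he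
      rw [hg, MvPolynomial.coeff_sub, MvPolynomial.coeff_C_mul,
        MvPolynomial.coeff_monomial] at hcoeff
      have hne : m.degree f ≠ e := by
        rintro rfl
        apply hcoeff
        rw [if_pos rfl, ha]
        change c - c * (m.leadingCoeff f)⁻¹ * m.leadingCoeff f = 0
        rw [inv_mul_cancel_right₀ hlc, sub_self]
      refine lt_of_le_of_ne (m.le_degree ?_) fun h => hne (m.toSyn.injective h).symm
      rw [MvPolynomial.mem_support_iff]
      intro h
      simp [hne, h] at hcoeff

/-- The cosets of the footprint monomials form a basis of `F[X_1, …, X_m]/I` as an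
`F`-vector space: they are linearly independent and span the quotient. -/
theorem stmt4 (F : Type*) [Field F] (n : ℕ) (m : MonomialOrder (Fin n))
    (I : Ideal (MvPolynomial (Fin n) F)) :
    LinearIndependent F (fun d : footprint m I =>
      Ideal.Quotient.mk I (MvPolynomial.monomial d.1 (1 : F))) ∧
    Submodule.span F (Set.range fun d : footprint m I =>
      Ideal.Quotient.mk I (MvPolynomial.monomial d.1 (1 : F))) = ⊤ := by
  refine ⟨linearIndependent_mk_monomial_footprint m I, eq_top_iff.mpr ?_⟩
  rintro x -
  obtain ⟨f, rfl⟩ := Ideal.Quotient.mk_surjective x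
  rw [f.as_sum, map_sum]
  exact Submodule.sum_mem _ fun d _ => mk_monomial_mem_span_footprint m I d _
end

section
/- Let F be a field, ≺ a monomial ordering on F[X_1, …, X_m], and I ⊆ F[X_1, …, X_m] an ideal whose footprint Δ_≺(I) is finite. Then the variety of I over the algebraic closure of F satisfies |V_{F̄}(I)| ≤ |Δ_≺(I)|. -/
open MvPolynomial in
/-- A linear map vanishing on `I` and on the monomials of the footprint of `I` is zero. -/
theorem linearMap_eq_zero_of_footprint {σ F M : Type*} [Field F] [AddCommGroup M] [Module F M]
    (m : MonomialOrder σ) (I : Ideal (MvPolynomial σ F)) (ψ : MvPolynomial σ F →ₗ[F] M)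
    (hI : ∀ f ∈ I, ψ f = 0) (hfoot : ∀ d ∈ footprint m I, ψ (monomial d 1) = 0) :
    ψ = 0 := by
  refine LinearMap.ext fun f => ?_
  obtain ⟨g, r, hf, -, hr⟩ := m.div_set (B := {b | b ∈ I ∧ b ≠ 0})
    (fun b hb => (m.leadingCoeff_ne_zero_iff.mpr hb.2).isUnit) f
  have hcomb : Finsupp.linearCombination _ (fun b : {b | b ∈ I ∧ b ≠ 0} => (b : MvPolynomial σ F)) g
      ∈ I := by
    rw [Finsupp.linearCombination_apply]
    exact I.sum_mem fun b _ => I.mul_mem_left _ b.2.1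
  rw [hf, map_add, hI _ hcomb, zero_add, r.as_sum, map_sum, LinearMap.zero_apply]
  refine Finset.sum_eq_zero fun d hd => ?_
  have hd' : d ∈ footprint m I := fun b hb hb0 hbd =>
    hr d hd b ⟨hb, hb0⟩ (le_of_eq hbd)
  rw [← mul_one (coeff d r), ← smul_eq_mul, ← smul_monomial, map_smul, hfoot d hd', smul_zero]

open MvPolynomial in
/-- The evaluation vectors, at the footprint monomials, of the zeros of `I` in an extension field
are linearly independent. -/
theorem linearIndependent_eval_footprint {σ F L : Type*} [Field F] [Field L] [Algebra F L]
    (m : MonomialOrder σ) (I : Ideal (MvPolynomial σ F)) :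
    LinearIndependent L
      (fun (x : {x : σ → L | ∀ f ∈ I, aeval x f = 0}) (d : footprint m I) =>
        aeval (x : σ → L) (monomial (d : σ →₀ ℕ) (1 : F))) := by
  have hinj : Function.Injective (fun x : {x : σ → L | ∀ f ∈ I, aeval x f = 0} =>
      ((aeval (x : σ → L) : MvPolynomial σ F →ₐ[F] L) : MvPolynomial σ F →* L)) := by
    intro x y hxy
    ext i
    simpa using DFunLike.congr_fun hxy (X i)
  have hind := (linearIndependent_monoidHom (MvPolynomial σ F) L).comp _ hinj
  rw [linearIndependent_iff'] at hind ⊢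
  intro s c hc
  refine hind s c ?_
  have hψ := linearMap_eq_zero_of_footprint m I
    (∑ x ∈ s, c x • (aeval (x : σ → L) : MvPolynomial σ F →ₐ[F] L).toLinearMap)
    (fun f hf => by
      simp only [LinearMap.sum_apply, LinearMap.smul_apply, AlgHom.toLinearMap_apply]
      exact Finset.sum_eq_zero fun x _ => by rw [x.2 f hf, smul_zero])
    (fun d hd => by simpa using congr_fun hc ⟨d, hd⟩)
  ext f
  simpa using LinearMap.congr_fun hψ f

/-- **The footprint bound.**  If the footprint `Δ_≺(I)` of an ideal
`I ⊆ F[X_1, …, X_m]` is finite, then the variety of `I` over the algebraic closure of `F`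
is finite, of cardinality at most `|Δ_≺(I)|`. -/
theorem stmt5 (F : Type*) [Field F] (n : ℕ) (m : MonomialOrder (Fin n))
    (I : Ideal (MvPolynomial (Fin n) F)) (hfin : (footprint m I).Finite) :
    {x : Fin n → AlgebraicClosure F | ∀ f ∈ I, MvPolynomial.aeval x f = 0}.Finite ∧
    Nat.card {x : Fin n → AlgebraicClosure F | ∀ f ∈ I, MvPolynomial.aeval x f = 0} ≤
      Nat.card (footprint m I) := by
  have hind := linearIndependent_eval_footprint (L := AlgebraicClosure F) m I
  have : Fintype (footprint m I) := hfin.fintype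
  have hV : Finite {x : Fin n → AlgebraicClosure F | ∀ f ∈ I, MvPolynomial.aeval x f = 0} :=
    hind.finite
  have := Fintype.ofFinite {x : Fin n → AlgebraicClosure F | ∀ f ∈ I, MvPolynomial.aeval x f = 0}
  refine ⟨Set.toFinite _, ?_⟩
  simpa only [Nat.card_eq_fintype_card, Module.finrank_fintype_fun_eq_card] using
    hind.fintype_card_le_finrank
end

section
/- Let q be a prime power and F_{q²} the finite field with q² elements. Then the Hermitian curve H = {(x, y) ∈ F_{q²}² : x^{q+1} = y^q + y} consists of exactly q³ points. -/
open Polynomial in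
/-- The equation `y ^ q = c * y` has at most `q` solutions in a field, for `1 < q`. -/
lemma natCard_pow_eq_mul_le {F : Type*} [Field F] {q : ℕ} (hq : 1 < q) (c : F) :
    Nat.card {y : F | y ^ q = c * y} ≤ q := by
  classical
  have hdeg : (X ^ q - C c * X : F[X]).natDegree = q := by
    rw [natDegree_sub_eq_left_of_natDegree_lt, natDegree_X_pow]
    rw [natDegree_X_pow]
    exact ((natDegree_C_mul_le c X).trans natDegree_X_le).trans_lt hq
  have hne : (X ^ q - C c * X : F[X]) ≠ 0 := by
    intro h
    rw [h, natDegree_zero] at hdeg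
    omega
  have hset : {y : F | y ^ q = c * y} = ((X ^ q - C c * X : F[X]).roots.toFinset : Set F) := by
    ext y
    simp [mem_roots hne, sub_eq_zero]
  rw [hset, Nat.card_coe_set_eq, Set.ncard_coe_finset]
  exact (Multiset.toFinset_card_le _).trans ((card_roots' _).trans hdeg.le)

/-- The trace `y ↦ y ^ q + y`, for `q` a power of the characteristic. -/
def tracePow (F : Type*) [Field F] (p e : ℕ) [ExpChar F p] : F →+ F :=
  (iterateFrobenius F p e : F →+ F) + AddMonoidHom.id F

lemma tracePow_apply {F : Type*} [Field F] (p e : ℕ) [ExpChar F p] (y : F) :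
    tracePow F p e y = y ^ p ^ e + y := by
  simp [tracePow, iterateFrobenius_def]

/-- Over the field with `q ^ 2` elements, the trace has kernel of order `q`, and its range is the
set of solutions of `z ^ q = z`. -/
lemma card_ker_tracePow_and_range_tracePow {F : Type*} [Field F] [Finite F] {p e : ℕ}
    [ExpChar F p] (hq : 1 < p ^ e) (hF : Nat.card F = (p ^ e) ^ 2) :
    Nat.card (tracePow F p e).ker = p ^ e ∧
      ((tracePow F p e).range : Set F) = {z : F | z ^ p ^ e = z} := by
  have hker : Nat.card (tracePow F p e).ker ≤ p ^ e := by
    refine le_trans (le_of_eq ?_) (natCard_pow_eq_mul_le hq (-1 : F))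
    refine Nat.card_congr (Equiv.subtypeEquivRight fun y => ?_)
    simp [AddMonoidHom.mem_ker, tracePow_apply, eq_neg_iff_add_eq_zero]
  have hfix : Set.ncard {z : F | z ^ p ^ e = z} ≤ p ^ e := by
    simpa [Nat.card_coe_set_eq] using natCard_pow_eq_mul_le hq (1 : F)
  have hsub : ((tracePow F p e).range : Set F) ⊆ {z : F | z ^ p ^ e = z} := by
    rintro _ ⟨y, rfl⟩
    have hy : (y ^ p ^ e) ^ p ^ e = y := by
      have := Fintype.ofFinite F
      rw [← pow_mul, ← sq, ← hF, Nat.card_eq_fintype_card, FiniteField.pow_card]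
    rw [Set.mem_ofPred_eq, tracePow_apply, add_pow_expChar_pow, hy, add_comm]
  have hmul : Nat.card (tracePow F p e).ker * Nat.card (tracePow F p e).range = (p ^ e) ^ 2 := by
    rw [← AddSubgroup.index_ker, AddSubgroup.card_mul_index, hF]
  have hrange : Nat.card (tracePow F p e).range ≤ Set.ncard {z : F | z ^ p ^ e = z} :=
    Set.ncard_le_ncard hsub
  refine ⟨by nlinarith, Set.eq_of_subset_of_ncard_le hsub (hfix.trans ?_)⟩
  change _ ≤ Nat.card (tracePow F p e).range
  nlinarith

/-- The Hermitian curve `x^{q+1} = y^q + y` over the field with `q²` elements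
(`q` a prime power) has exactly `q³` affine points. -/
theorem stmt7 (p e : ℕ) (hp : p.Prime) (he : 0 < e) (q : ℕ) (hq : q = p ^ e)
    (F : Type*) [Field F] [Fintype F] (hF : Fintype.card F = q ^ 2) :
    Nat.card {xy : F × F | xy.1 ^ (q + 1) = xy.2 ^ q + xy.2} = q ^ 3 := by
  subst hq
  have : Fact p.Prime := ⟨hp⟩
  have : CharP F p := charP_of_card_eq_prime_pow (hF.trans (pow_mul p e 2).symm)
  have : ExpChar F p := .prime hp
  obtain ⟨hker, hrange⟩ := card_ker_tracePow_and_range_tracePow (F := F)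
    (Nat.one_lt_pow he.ne' hp.one_lt) (Nat.card_eq_fintype_card.trans hF)
  have hfiber (x : F) : Nat.card {y : F // x ^ (p ^ e + 1) = y ^ p ^ e + y} = p ^ e := by
    have hx : x ^ (p ^ e + 1) ∈ ((tracePow F p e).range : Set F) := by
      rw [hrange, Set.mem_ofPred_eq, ← pow_mul, add_mul, one_mul, pow_add, ← sq, ← hF,
        FiniteField.pow_card, pow_succ']
    obtain ⟨y₀, hy₀⟩ := hx
    refine (Nat.card_congr ((Equiv.subtypeEquivRight fun y => ?_).trans
      ((tracePow F p e).fiberEquivKer y₀))).trans hker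
    rw [← hy₀, ← tracePow_apply, Set.mem_preimage, Set.mem_singleton_iff, eq_comm]
  calc Nat.card {xy : F × F | xy.1 ^ (p ^ e + 1) = xy.2 ^ p ^ e + xy.2}
      = Nat.card (Σ x : F, {y : F // x ^ (p ^ e + 1) = y ^ p ^ e + y}) :=
        Nat.card_congr (Equiv.subtypeProdEquivSigmaSubtype
          fun x y : F => x ^ (p ^ e + 1) = y ^ p ^ e + y)
    _ = (p ^ e) ^ 3 := by
        simp only [Nat.card_sigma, hfiber, Finset.sum_const, Finset.card_univ, hF, smul_eq_mul]
        ring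
end

section
/- Let q be a prime power, F_{q²} the finite field with q² elements, and H = {(x, y) ∈ F_{q²}² : x^{q+1} = y^q + y}, a set of q³ points P_1, …, P_{q³}. Then the q³ vectors ev(X^iY^j) = (P_1^{(i,j)}, …, P_{q³}^{(i,j)}), where P^{(i,j)} = x^i y^j for P = (x,y), indexed by 0 ≤ i < q², 0 ≤ j < q, form a basis of F_{q²}^{q³} as a vector space over F_{q²}. Equivalently, the evaluation map F(X,Y) ↦ (F(P_1), …, F(P_{q³})) restricted to polynomials with support in {X^iY^j : 0 ≤ i < q², 0 ≤ j < q} is a linear bijection onto F_{q²}^{q³}. -/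
open Polynomial in
/-- A linear combination of `1, x, …, x ^ (n - 1)` that vanishes at `n` points is trivial. -/
theorem coeff_eq_zero_of_sum_pow_eq_zero {F : Type*} [Field F] {n : ℕ} (S : Finset F)
    (hS : n ≤ S.card) (c : Fin n → F) (h : ∀ x ∈ S, ∑ i, c i * x ^ (i : ℕ) = 0) (i : Fin n) :
    c i = 0 := by
  have hdeg : (∑ i : Fin n, C (c i) * X ^ (i : ℕ)).degree < (n : WithBot ℕ) :=
    (degree_sum_le _ _).trans_lt <| (Finset.sup_lt_iff (WithBot.bot_lt_coe n)).2 fun i _ =>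
      (degree_C_mul_X_pow_le _ _).trans_lt (Nat.cast_lt.2 i.2)
  have hzero : (∑ i : Fin n, C (c i) * X ^ (i : ℕ)) = 0 :=
    eq_zero_of_degree_lt_of_eval_finset_eq_zero S
      (hdeg.trans_le (by exact_mod_cast hS)) fun x hx => by
        simpa [eval_finsetSum] using h x hx
  simpa [finsetSum_coeff, coeff_C_mul, coeff_X_pow, ← Fin.ext_iff] using
    congrArg (fun f : F[X] => f.coeff i) hzero

open Polynomial in
/-- Over a field with `q ^ 2` elements, the equation `y ^ q + y = c` has exactly `q` solutions
whenever `c ^ q = c`. -/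
theorem card_filter_pow_add_self_eq {p e q : ℕ} (hp : p.Prime) (he : 0 < e) (hq : q = p ^ e)
    {F : Type*} [Field F] [Fintype F] [DecidableEq F] (hF : Fintype.card F = q ^ 2)
    (c : F) (hc : c ^ q = c) :
    (Finset.univ.filter fun y : F => c = y ^ q + y).card = q := by
  have : Fact p.Prime := ⟨hp⟩
  have : CharP F p := charP_of_card_eq_prime_pow (f := e * 2) (by rw [hF, hq, pow_mul])
  have hq1 : 1 < q := hq ▸ Nat.one_lt_pow he.ne' hp.one_lt
  set f : F[X] := X ^ q + (X - C c) with hf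
  have hlt : (X - C c : F[X]).degree < q := by
    rw [degree_X_sub_C]; exact_mod_cast hq1
  have hmonic : f.Monic := monic_X_pow_add hlt
  have hdeg : f.natDegree = q := natDegree_eq_of_degree_eq_some (by
    rw [hf, degree_add_eq_left_of_degree_lt (by rwa [degree_X_pow]), degree_X_pow])
  have hpow : f ^ q - f = X ^ Fintype.card F - X := by
    have : f ^ q = (X ^ q) ^ q + (X ^ q - C c ^ q) := by
      rw [hf, hq, add_pow_char_pow, sub_pow_char_pow]
    rw [this, ← C_pow, hc, hF, hf]
    ring
  have hdvd : f ∣ X ^ Fintype.card F - X :=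
    hpow ▸ dvd_sub (dvd_pow_self f (by omega)) dvd_rfl
  have hne : (X ^ Fintype.card F - X : F[X]) ≠ 0 :=
    FiniteField.X_pow_card_sub_X_ne_zero F Fintype.one_lt_card
  have hsplits : f.Splits := Splits.of_dvd (by
    rw [splits_iff_card_roots, FiniteField.roots_X_pow_card_sub_X,
      FiniteField.X_pow_card_sub_X_natDegree_eq F Fintype.one_lt_card]
    rfl) hne hdvd
  have hnodup : f.roots.Nodup := Multiset.nodup_of_le (roots.le_of_dvd hne hdvd) (by
    rw [FiniteField.roots_X_pow_card_sub_X]; exact Finset.univ.nodup)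
  have hroots : (Finset.univ.filter fun y : F => c = y ^ q + y) = f.roots.toFinset := by
    ext y
    rw [Multiset.mem_toFinset, mem_roots hmonic.ne_zero]
    simp only [Finset.mem_filter, Finset.mem_univ, true_and, IsRoot.def, hf, eval_add, eval_pow, eval_X, eval_sub, eval_C,
      ← add_sub_assoc, sub_eq_zero]
    exact eq_comm
  rw [hroots, Multiset.toFinset_card_of_nodup hnodup, splits_iff_card_roots.1 hsplits, hdeg]


/-- Let `H` be the Hermitian curve over `F_{q²}`.  The `q³` evaluation vectors
`ev(X^i Y^j) = ((x, y) ↦ x^i y^j)_{(x,y) ∈ H}` for `0 ≤ i < q²`, `0 ≤ j < q` form a basis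
of the space of functions `H → F_{q²}`: they are linearly independent and span it. -/
theorem stmt8 (p e : ℕ) (hp : p.Prime) (he : 0 < e) (q : ℕ) (hq : q = p ^ e)
    (F : Type*) [Field F] [Fintype F] (hF : Fintype.card F = q ^ 2) :
    LinearIndependent F
      (fun ij : Fin (q ^ 2) × Fin q =>
        fun P : {xy : F × F // xy.1 ^ (q + 1) = xy.2 ^ q + xy.2} =>
          P.1.1 ^ (ij.1 : ℕ) * P.1.2 ^ (ij.2 : ℕ)) ∧
    Submodule.span F (Set.range
      (fun ij : Fin (q ^ 2) × Fin q =>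
        fun P : {xy : F × F // xy.1 ^ (q + 1) = xy.2 ^ q + xy.2} =>
          P.1.1 ^ (ij.1 : ℕ) * P.1.2 ^ (ij.2 : ℕ))) = ⊤ := by
  classical
  have hfiber (x : F) : (Finset.univ.filter fun y : F => x ^ (q + 1) = y ^ q + y).card = q :=
    card_filter_pow_add_self_eq hp he hq hF _ <| by
      rw [← pow_mul, show (q + 1) * q = q ^ 2 + q by ring, pow_add, ← hF, FiniteField.pow_card,
        pow_succ']
  have hcard : Fintype.card {xy : F × F // xy.1 ^ (q + 1) = xy.2 ^ q + xy.2} = q ^ 2 * q := by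
    rw [Fintype.card_congr (Equiv.subtypeProdEquivSigmaSubtype
      fun x y : F => x ^ (q + 1) = y ^ q + y), Fintype.card_sigma]
    simp [Fintype.card_subtype, hfiber, hF]
  refine and_iff_left_of_imp (fun hli => hli.span_eq_top_of_card_eq_finrank' ?_) |>.2 ?_
  · rw [Fintype.linearIndependent_iff]
    rintro g hg ⟨i, j⟩
    refine coeff_eq_zero_of_sum_pow_eq_zero Finset.univ (by rw [Finset.card_univ, hF])
      (fun i => g (i, j)) (fun x _ => ?_) i
    refine coeff_eq_zero_of_sum_pow_eq_zero _ (hfiber x).ge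
      (fun j => ∑ i, g (i, j) * x ^ (i : ℕ)) (fun y hy => ?_) j
    have := congrFun hg ⟨(x, y), (Finset.mem_filter.1 hy).2⟩
    simpa [Fintype.sum_prod_type_right, Finset.sum_mul, mul_assoc] using this
  · simp only [Fintype.card_prod, Fintype.card_fin, Module.finrank_fintype_fun_eq_card, hcard]
end

section
/- Let q be a prime power, F_{q²} the finite field with q² elements, and H = {(x, y) ∈ F_{q²}² : x^{q+1} = y^q + y}. Let F(X,Y) ∈ F_{q²}[X,Y] be a nonzero polynomial whose support is contained in {X^iY^j : 0 ≤ i < q², 0 ≤ j < q}, and let λ = max{qi + (q+1)j : X^iY^j in the support of F}. Then F vanishes at no more than λ points of H; equivalently, the codeword ev(F) = (F(P))_{P∈H} ∈ F_{q²}^{q³} has Hamming weight at least q³ − λ. -/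
namespace HermitianCurve

/-- The weight `q * a + (q + 1) * b` of the monomial `X ^ a * Y ^ b`. -/
def weight (q a b : ℕ) : ℕ := q * a + (q + 1) * b

/-- The numerical semigroup generated by `q` and `q + 1`. -/
def weights (q : ℕ) : Set ℕ := {s | ∃ a b, weight q a b = s}

/-- The function induced by the monomial `X ^ a * Y ^ b` on a set of points of the plane. -/
def monomialEval {F : Type*} [Field F] (Z : Set (F × F)) (a b : ℕ) : Z → F :=
  fun P => P.1.1 ^ a * P.1.2 ^ b

lemma mem_weights_of_sq_le {q n : ℕ} (hq : 0 < q) (hn : q ^ 2 ≤ n) : n ∈ weights q := by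
  have hr := Nat.mod_lt n hq
  have hu : q ≤ n / q := (Nat.le_div_iff_mul_le hq).2 (by nlinarith)
  refine ⟨n / q - n % q, n % q, ?_⟩
  obtain ⟨k, hk⟩ := Nat.exists_eq_add_of_le (hr.le.trans hu)
  have h := Nat.div_add_mod n q
  rw [hk, Nat.add_sub_cancel_left, weight]
  rw [hk] at h
  linarith

lemma weight_injective_of_lt {q a b a' b' : ℕ} (hb : b < q) (hb' : b' < q)
    (h : weight q a b = weight q a' b') : a = a' ∧ b = b' := by
  have hq : 0 < q := by omega
  have hbb : b = b' := by
    have h1 : ∀ a b, weight q a b = b + q * (a + b) := fun a b => by rw [weight]; ring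
    rw [h1, h1] at h
    have h2 := congrArg (· % q) h
    simpa [Nat.add_mul_mod_self_left, Nat.mod_eq_of_lt hb, Nat.mod_eq_of_lt hb'] using h2
  subst hbb
  simp only [weight, add_left_inj] at h
  exact ⟨Nat.eq_of_mul_eq_mul_left hq h, rfl⟩

lemma exists_of_weight_eq {q a b a' b' : ℕ} (hq : 0 < q) (hbb : b ≤ b')
    (h : weight q a b = weight q a' b') : ∃ k, b' = b + q * k ∧ a = a' + (q + 1) * k := by
  obtain ⟨c, rfl⟩ := Nat.exists_eq_add_of_le hbb
  have h1 : q * a = q * a' + (q + 1) * c := by simp only [weight] at h; linarith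
  have h2 : q ∣ c := by
    have h3 : q ∣ (q * a' + q * c) + c := ⟨a, by linarith⟩
    exact (Nat.dvd_add_right (by rw [← mul_add]; exact dvd_mul_right _ _)).1 h3
  obtain ⟨k, rfl⟩ := h2
  exact ⟨k, rfl, Nat.eq_of_mul_eq_mul_left hq (by linarith)⟩

open Classical in
/-- The complement of the translate of `weights q` by one of its elements `l` has at most `l`
elements. -/
lemma exists_finset_weights_diff {q l : ℕ} (hq : 0 < q) (hl : l ∈ weights q) :
    ∃ T : Finset ℕ, T.card ≤ l ∧
      ∀ s, s ∈ weights q → (∀ t ∈ weights q, l + t ≠ s) → s ∈ T := by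
  set A := (Finset.range (q ^ 2)).filter (· ∈ weights q) with hA
  set B := (Finset.range (l + q ^ 2)).filter (· ∈ weights q) with hB
  have hsub : A.image (l + ·) ⊆ B := by
    intro s hs
    simp only [hA, hB, Finset.mem_image, Finset.mem_filter, Finset.mem_range] at hs ⊢
    obtain ⟨t, ⟨ht, a, b, hab⟩, rfl⟩ := hs
    obtain ⟨a', b', hab'⟩ := hl
    exact ⟨by omega, a' + a, b' + b, by rw [← hab, ← hab']; simp only [weight]; ring⟩
  have hcardA : (A.image (l + ·)).card = A.card :=
    Finset.card_image_of_injective _ (add_right_injective l)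
  have hcardB : B.card ≤ A.card + l := by
    have : B ⊆ A ∪ Finset.Ico (q ^ 2) (l + q ^ 2) := by
      intro s hs
      simp only [hA, hB, Finset.mem_union, Finset.mem_filter, Finset.mem_range,
        Finset.mem_Ico] at hs ⊢
      by_cases h : s < q ^ 2
      · exact Or.inl ⟨h, hs.2⟩
      · exact Or.inr ⟨not_lt.1 h, hs.1⟩
    refine (Finset.card_le_card this).trans ((Finset.card_union_le _ _).trans ?_)
    simp
  refine ⟨B \ A.image (l + ·), ?_, ?_⟩
  · rw [Finset.card_sdiff_of_subset hsub, hcardA]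
    omega
  · intro s hs hst
    simp only [hA, hB, Finset.mem_sdiff, Finset.mem_image, Finset.mem_filter, Finset.mem_range]
    refine ⟨⟨?_, hs⟩, ?_⟩
    · by_contra! h
      exact hst (s - l) (mem_weights_of_sq_le hq (by omega)) (by omega)
    · rintro ⟨t, ⟨-, ht⟩, rfl⟩
      exact hst t ht rfl

section Field

variable {F : Type*} [Field F]

/-- On the Hermitian curve, monomials of equal weight agree modulo monomials of smaller weight. -/
lemma monomialEval_mem_of_weight_eq {q : ℕ} (hq : 2 ≤ q) {Z : Set (F × F)}
    (hZ : ∀ P ∈ Z, P.1 ^ (q + 1) = P.2 ^ q + P.2) (W : Submodule F (Z → F)) {s : ℕ}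
    (hW : ∀ a b, weight q a b < s → monomialEval Z a b ∈ W) {a b a' b' : ℕ}
    (hab : weight q a b = s) (hab' : weight q a' b' = s) (h : monomialEval Z a b ∈ W) :
    monomialEval Z a' b' ∈ W := by
  have key : ∀ k a b, weight q (a + (q + 1) * k) b = s →
      monomialEval Z (a + (q + 1) * k) b - monomialEval Z a (b + q * k) ∈ W := by
    intro k
    induction k with
    | zero => intro a b _; simp
    | succ k ih =>
      intro a b hs
      have h1 := ih a (b + q) (by rw [← hs]; simp only [weight]; ring)
      have h2 : monomialEval Z (a + (q + 1) * k) (b + 1) ∈ W := by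
        apply hW
        rw [← hs]
        simp only [weight]
        nlinarith
      convert add_mem h1 h2 using 1
      funext P
      have hP := hZ P.1 P.2
      simp only [monomialEval, Pi.sub_apply, Pi.add_apply]
      have e1 : P.1.1 ^ (a + (q + 1) * (k + 1)) =
          P.1.1 ^ (a + (q + 1) * k) * (P.1.2 ^ q + P.1.2) := by rw [← hP]; ring
      rw [e1]
      ring
  have hq0 : 0 < q := by omega
  rcases le_total b b' with hbb | hbb
  · obtain ⟨k, rfl, rfl⟩ := exists_of_weight_eq hq0 hbb (hab.trans hab'.symm)
    exact (Submodule.sub_mem_iff_right W h).1 (key k _ _ hab)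
  · obtain ⟨k, rfl, rfl⟩ := exists_of_weight_eq hq0 hbb (hab'.trans hab.symm)
    exact (Submodule.sub_mem_iff_left W h).1 (key k _ _ hab')

/-- If `f` vanishes on `Z`, a monomial multiple of its leading monomial agrees on `Z` with a
combination of monomials of smaller weight. -/
lemma monomialEval_add_leading_mem {q : ℕ} {Z : Set (F × F)} {f : MvPolynomial (Fin 2) F}
    (hf : ∀ P ∈ Z, MvPolynomial.eval ![P.1, P.2] f = 0) (W : Submodule F (Z → F))
    {m : Fin 2 →₀ ℕ} (hm : m ∈ f.support) (a b : ℕ)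
    (hlt : ∀ d ∈ f.support, d ≠ m → weight q (d 0) (d 1) < weight q (m 0) (m 1))
    (hW : ∀ a' b', weight q a' b' < weight q (m 0) (m 1) + weight q a b →
      monomialEval Z a' b' ∈ W) :
    monomialEval Z (m 0 + a) (m 1 + b) ∈ W := by
  classical
  have hsum : ∑ d ∈ f.support, f.coeff d • monomialEval Z (d 0 + a) (d 1 + b) = 0 := by
    funext P
    have h := hf P.1 P.2
    rw [MvPolynomial.eval_eq'] at h
    simp only [Fin.prod_univ_two, Matrix.cons_val_zero, Matrix.cons_val_one] at h
    have h' := congrArg (· * (P.1.1 ^ a * P.1.2 ^ b)) h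
    simp only [zero_mul, Finset.sum_mul] at h'
    simp only [Finset.sum_apply, Pi.smul_apply, smul_eq_mul, monomialEval, Pi.zero_apply]
    rw [← h']
    exact Finset.sum_congr rfl fun d _ => by ring
  rw [← Finset.add_sum_erase _ _ hm] at hsum
  have hrest : ∑ d ∈ f.support.erase m, f.coeff d • monomialEval Z (d 0 + a) (d 1 + b) ∈ W := by
    refine Submodule.sum_mem _ fun d hd => W.smul_mem _ (hW _ _ ?_)
    have := hlt d (Finset.mem_of_mem_erase hd) (Finset.ne_of_mem_erase hd)
    simp only [weight] at this ⊢
    linarith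
  have hlead : f.coeff m • monomialEval Z (m 0 + a) (m 1 + b) ∈ W := by
    rw [eq_neg_of_add_eq_zero_left hsum]
    exact W.neg_mem hrest
  exact (W.smul_mem_iff (MvPolynomial.mem_support_iff.1 hm)).1 hlead

/-- Every function on a set of points of a finite plane is a combination of monomials. -/
lemma eq_top_of_forall_monomialEval_mem [Finite F] (Z : Set (F × F)) (W : Submodule F (Z → F))
    (hW : ∀ a b, monomialEval Z a b ∈ W) : W = ⊤ := by
  classical
  have := Fintype.ofFinite F
  rw [eq_top_iff]
  rintro g -
  let G : (Fin 2 → F) → F := fun v => if h : (v 0, v 1) ∈ Z then g ⟨(v 0, v 1), h⟩ else 0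
  have hG : G ∈ (MvPolynomial.restrictDegree (Fin 2) F (Fintype.card F - 1)).map
      (MvPolynomial.evalₗ F (Fin 2)) := by
    rw [MvPolynomial.map_restrict_dom_evalₗ]
    trivial
  obtain ⟨f, -, hf⟩ := hG
  have hg : g = ∑ d ∈ f.support, f.coeff d • monomialEval Z (d 0) (d 1) := by
    funext P
    have h := congrFun hf ![P.1.1, P.1.2]
    rw [MvPolynomial.evalₗ_apply, MvPolynomial.eval_eq'] at h
    simp only [Fin.prod_univ_two, Matrix.cons_val_zero, Matrix.cons_val_one, G, Prod.mk.eta,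
      Subtype.coe_prop, dif_pos, Subtype.coe_eta] at h
    simpa [monomialEval] using h.symm
  rw [hg]
  exact Submodule.sum_mem _ fun d _ => W.smul_mem _ (hW _ _)

/-- A set of points of the Hermitian curve on which `f` vanishes has at most as many points as the
weight of the leading monomial of `f`. -/
lemma card_le_weight_of_eval_eq_zero [Finite F] {q : ℕ} (hq : 2 ≤ q) {Z : Set (F × F)}
    (hZ : ∀ P ∈ Z, P.1 ^ (q + 1) = P.2 ^ q + P.2) {f : MvPolynomial (Fin 2) F}
    (hf : ∀ P ∈ Z, MvPolynomial.eval ![P.1, P.2] f = 0) {m : Fin 2 →₀ ℕ} (hm : m ∈ f.support)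
    (hlt : ∀ d ∈ f.support, d ≠ m → weight q (d 0) (d 1) < weight q (m 0) (m 1)) :
    Nat.card Z ≤ weight q (m 0) (m 1) := by
  classical
  have := Fintype.ofFinite Z
  obtain ⟨T, hTcard, hT⟩ :=
    exists_finset_weights_diff (q := q) (l := weight q (m 0) (m 1)) (by omega) ⟨_, _, rfl⟩
  have hrep : ∀ s, ∃ r : ℕ × ℕ, s ∈ weights q → weight q r.1 r.2 = s := by
    intro s
    by_cases h : s ∈ weights q
    · obtain ⟨a, b, hab⟩ := h
      exact ⟨(a, b), fun _ => hab⟩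
    · exact ⟨0, fun h' => absurd h' h⟩
  choose r hr using hrep
  let B : Finset (Z → F) := T.image fun s => monomialEval Z (r s).1 (r s).2
  let W : Submodule F (Z → F) := Submodule.span F B
  have hmem : ∀ s a b, weight q a b = s → monomialEval Z a b ∈ W := by
    intro s
    induction s using Nat.strong_induction_on with
    | _ s ih =>
      intro a b hab
      have hW : ∀ a b, weight q a b < s → monomialEval Z a b ∈ W :=
        fun a b h => ih _ h a b rfl
      by_cases h : ∃ t ∈ weights q, weight q (m 0) (m 1) + t = s
      · obtain ⟨t, ⟨a', b', rfl⟩, rfl⟩ := h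
        refine monomialEval_mem_of_weight_eq hq hZ W hW (a := m 0 + a') (b := m 1 + b') ?_ hab
          (monomialEval_add_leading_mem hf W hm a' b' hlt hW)
        simp only [weight]
        ring
      · push Not at h
        have hs : s ∈ weights q := ⟨a, b, hab⟩
        exact monomialEval_mem_of_weight_eq hq hZ W hW (hr s hs) hab
          (Submodule.subset_span (Finset.mem_coe.2 (Finset.mem_image_of_mem _ (hT s hs h))))
  have htop : W = ⊤ := eq_top_of_forall_monomialEval_mem Z W fun a b => hmem _ a b rfl
  calc Nat.card Z = Module.finrank F (Z → F) := by
        rw [Module.finrank_fintype_fun_eq_card, Nat.card_eq_fintype_card]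
    _ = Module.finrank F W := by rw [htop, finrank_top]
    _ ≤ B.card := finrank_span_finset_le_card B
    _ ≤ T.card := Finset.card_image_le
    _ ≤ _ := hTcard

open Polynomial in
lemma card_pow_add_mul_eq_le [Fintype F] [DecidableEq F] {q : ℕ} (hq : 2 ≤ q) (c d : F) :
    (Finset.univ.filter fun y : F => y ^ q + c * y = d).card ≤ q := by
  have hlow : (C c * X - C d : F[X]).degree < q := by
    rw [sub_eq_add_neg, ← C_neg]
    exact degree_linear_le.trans_lt (by exact_mod_cast hq)
  have hdeg : (X ^ q + (C c * X - C d) : F[X]).natDegree = q := by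
    apply natDegree_eq_of_degree_eq_some
    rw [degree_add_eq_left_of_degree_lt (by rwa [degree_X_pow]), degree_X_pow]
  have hne : (X ^ q + (C c * X - C d) : F[X]) ≠ 0 := by
    intro h
    rw [h, natDegree_zero] at hdeg
    omega
  calc _ ≤ (X ^ q + (C c * X - C d) : F[X]).roots.toFinset.card := by
        refine Finset.card_le_card fun y hy => ?_
        have hy' : y ^ q + c * y = d := by simpa using hy
        rw [Multiset.mem_toFinset, mem_roots hne]
        simp [← hy']
    _ ≤ _ := (Multiset.toFinset_card_le _).trans ((card_roots' _).trans hdeg.le)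

/-- Over a field with `q ^ 2` elements, `y ^ q + y = c` has `q` solutions if `c ^ q = c`. -/
lemma card_trace_fiber [Fintype F] [DecidableEq F] {p e q : ℕ} (hp : p.Prime) (he : 0 < e)
    (hq : q = p ^ e) (hF : Fintype.card F = q ^ 2) {c : F} (hc : c ^ q = c) :
    (Finset.univ.filter fun y : F => y ^ q + y = c).card = q := by
  have : Fact p.Prime := ⟨hp⟩
  have : CharP F p := charP_of_card_eq_prime_pow (f := e * 2) (by rw [hF, hq, pow_mul])
  have hq2 : 2 ≤ q := hq ▸ hp.two_le.trans (Nat.le_self_pow he.ne' p)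
  have hfix : (Finset.univ.filter fun y : F => y ^ q = y).card ≤ q := by
    simpa [← sub_eq_add_neg, sub_eq_zero] using card_pow_add_mul_eq_le (F := F) hq2 (-1) 0
  have hfiber : ∀ d : F, (Finset.univ.filter fun y : F => y ^ q + y = d).card ≤ q := by
    simpa using card_pow_add_mul_eq_le (F := F) hq2 1
  have hmaps : ∀ y ∈ (Finset.univ : Finset F),
      y ^ q + y ∈ Finset.univ.filter fun y : F => y ^ q = y := by
    intro y _
    have hy : (y ^ q) ^ q = y := by rw [← pow_mul, ← sq, ← hF, FiniteField.pow_card]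
    have hadd : (y ^ q + y) ^ q = (y ^ q) ^ q + y ^ q := by rw [hq, add_pow_char_pow]
    rw [Finset.mem_filter, hadd, hy, add_comm]
    exact ⟨Finset.mem_univ _, rfl⟩
  have hsum := Finset.card_eq_sum_card_fiberwise hmaps
  rw [Finset.card_univ, hF] at hsum
  refine (hfiber c).antisymm (not_lt.1 fun hlt => ?_)
  have hcontra := Finset.sum_lt_sum (s := Finset.univ.filter fun y : F => y ^ q = y)
    (fun d _ => hfiber d) ⟨c, Finset.mem_filter.2 ⟨Finset.mem_univ c, hc⟩, hlt⟩
  rw [← hsum, Finset.sum_const, smul_eq_mul] at hcontra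
  nlinarith

/-- The Hermitian curve over a field with `q ^ 2` elements has `q ^ 3` points. -/
lemma card_points [Fintype F] {p e q : ℕ} (hp : p.Prime) (he : 0 < e)
    (hq : q = p ^ e) (hF : Fintype.card F = q ^ 2) :
    Nat.card {P : F × F | P.1 ^ (q + 1) = P.2 ^ q + P.2} = q ^ 3 := by
  classical
  have hfiber : ∀ x : F,
      (Finset.univ.filter fun y : F => x ^ (q + 1) = y ^ q + y).card = q := by
    intro x
    have hx : (x ^ q) ^ q = x := by rw [← pow_mul, ← sq, ← hF, FiniteField.pow_card]
    simp only [eq_comm (a := x ^ (q + 1))]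
    apply card_trace_fiber hp he hq hF
    rw [pow_succ, mul_pow, hx, mul_comm]
  rw [Nat.subtype_card (Finset.univ.filter fun P : F × F => P.1 ^ (q + 1) = P.2 ^ q + P.2)
    (by simp), Finset.card_filter, Fintype.sum_prod_type]
  simp only [← Finset.card_filter, hfiber, Finset.sum_const, Finset.card_univ, hF, smul_eq_mul]
  ring

end Field

end HermitianCurve

/-- Let `H` be the Hermitian curve over `F_{q²}` (with `q³` points).  A nonzero polynomial
`F(X,Y)` with support in `{X^i Y^j : 0 ≤ i < q², 0 ≤ j < q}` vanishes at no more than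
`λ := max{qi + (q+1)j : X^i Y^j ∈ supp F}` points of `H`; equivalently, the evaluation
codeword `ev F` has Hamming weight at least `q³ − λ`. -/
theorem stmt9 (p e : ℕ) (hp : p.Prime) (he : 0 < e) (q : ℕ) (hq : q = p ^ e)
    (F : Type*) [Field F] [Fintype F] (hF : Fintype.card F = q ^ 2)
    (f : MvPolynomial (Fin 2) F) (hf : f ≠ 0)
    (hsupp : ∀ d ∈ f.support, d 0 < q ^ 2 ∧ d 1 < q) :
    Nat.card {xy : F × F | xy.1 ^ (q + 1) = xy.2 ^ q + xy.2 ∧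
        MvPolynomial.eval ![xy.1, xy.2] f = 0} ≤
      f.support.sup (fun d => q * d 0 + (q + 1) * d 1) ∧
    q ^ 3 - f.support.sup (fun d => q * d 0 + (q + 1) * d 1) ≤
      Nat.card {xy : F × F | xy.1 ^ (q + 1) = xy.2 ^ q + xy.2 ∧
        MvPolynomial.eval ![xy.1, xy.2] f ≠ 0} := by
  have hq2 : 2 ≤ q := hq ▸ hp.two_le.trans (Nat.le_self_pow he.ne' p)
  obtain ⟨m, hm, hsup⟩ := Finset.exists_mem_eq_sup f.support
    (MvPolynomial.support_nonempty.2 hf) (fun d => q * d 0 + (q + 1) * d 1)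
  have hlt : ∀ d ∈ f.support, d ≠ m →
      HermitianCurve.weight q (d 0) (d 1) < HermitianCurve.weight q (m 0) (m 1) := by
    intro d hd hdm
    have hle := Finset.le_sup (f := fun d : Fin 2 →₀ ℕ => q * d 0 + (q + 1) * d 1) hd
    rw [hsup] at hle
    refine lt_of_le_of_ne hle fun h => hdm ?_
    obtain ⟨h0, h1⟩ :=
      HermitianCurve.weight_injective_of_lt (hsupp d hd).2 (hsupp m hm).2 h
    ext i
    fin_cases i
    · exact h0
    · exact h1
  have hzeros : Nat.card {xy : F × F | xy.1 ^ (q + 1) = xy.2 ^ q + xy.2 ∧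
      MvPolynomial.eval ![xy.1, xy.2] f = 0} ≤
      f.support.sup (fun d => q * d 0 + (q + 1) * d 1) := by
    rw [hsup]
    exact HermitianCurve.card_le_weight_of_eval_eq_zero hq2 (fun P hP => hP.1)
      (fun P hP => hP.2) hm hlt
  refine ⟨hzeros, ?_⟩
  have hcard := HermitianCurve.card_points hp he hq hF
  have hunion : {P : F × F | P.1 ^ (q + 1) = P.2 ^ q + P.2} =
      {xy : F × F | xy.1 ^ (q + 1) = xy.2 ^ q + xy.2 ∧
        MvPolynomial.eval ![xy.1, xy.2] f = 0} ∪
      {xy : F × F | xy.1 ^ (q + 1) = xy.2 ^ q + xy.2 ∧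
        MvPolynomial.eval ![xy.1, xy.2] f ≠ 0} := by
    ext P
    simp only [Set.mem_ofPred_eq, Set.mem_union]
    tauto
  rw [hunion, Nat.card_coe_set_eq] at hcard
  have hle := Set.ncard_union_le {xy : F × F | xy.1 ^ (q + 1) = xy.2 ^ q + xy.2 ∧
      MvPolynomial.eval ![xy.1, xy.2] f = 0} {xy : F × F | xy.1 ^ (q + 1) = xy.2 ^ q + xy.2 ∧
      MvPolynomial.eval ![xy.1, xy.2] f ≠ 0}
  rw [Nat.card_coe_set_eq] at hzeros ⊢
  omega
end

section
/- Let T ≥ 1 be an integer and δ a real number with T ≤ δ ≤ T². Then the number of pairs of integers (i, j) with 0 ≤ i, j ≤ T − 1 and (T − i)(T − j) ≥ δ is at least T² − δ + δ·ln(δ/T²). -/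
/-- The area of the part of `[0, x] × [0, t]` that lies on or above the hyperbola `a * b = δ`. -/
noncomputable def areaAboveHyperbola (t δ x : ℝ) : ℝ :=
  t * max x (δ / t) - δ + δ * Real.log (δ / t / max x (δ / t))

lemma areaAboveHyperbola_zero {t δ : ℝ} (ht : 0 < t) (hδ : 0 < δ) :
    areaAboveHyperbola t δ 0 = 0 := by
  have hc : 0 < δ / t := div_pos hδ ht
  rw [areaAboveHyperbola, max_eq_right hc.le, div_self hc.ne', Real.log_one]
  field_simp
  ring

lemma areaAboveHyperbola_self {t δ : ℝ} (ht : 0 < t) (h : δ ≤ t ^ 2) :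
    areaAboveHyperbola t δ t = t ^ 2 - δ + δ * Real.log (δ / t ^ 2) := by
  have hc : δ / t ≤ t := by rwa [div_le_iff₀ ht, ← sq]
  rw [areaAboveHyperbola, max_eq_left hc, div_div, ← sq]

/-- A vertical strip of width one has area at most the height of its right edge. -/
lemma areaAboveHyperbola_sub_le {t δ : ℝ} (ht : 0 < t) (hδ : 0 < δ) (x : ℝ) :
    areaAboveHyperbola t δ x - areaAboveHyperbola t δ (x - 1) ≤ t - δ / max x (δ / t) := by
  have hc : 0 < δ / t := div_pos hδ ht
  unfold areaAboveHyperbola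
  set c := δ / t
  set m := max x c
  set n := max (x - 1) c
  have hm0 : 0 < m := lt_max_of_lt_right hc
  have hn0 : 0 < n := lt_max_of_lt_right hc
  have hmn : m - n ≤ 1 := by
    have : m ≤ n + 1 := max_le (by linarith [le_max_left (x - 1) c])
      (by linarith [le_max_right (x - 1) c])
    linarith
  have hnonneg : 0 ≤ t - δ / m := by
    rw [sub_nonneg, div_le_iff₀ hm0, ← div_le_iff₀' ht]
    exact le_max_right _ _
  have hlog : Real.log (n / m) ≤ n / m - 1 := Real.log_le_sub_one_of_pos (div_pos hn0 hm0)
  rw [Real.log_div hn0.ne' hm0.ne'] at hlog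
  rw [Real.log_div hc.ne' hm0.ne', Real.log_div hc.ne' hn0.ne']
  calc _ = t * (m - n) + δ * (Real.log n - Real.log m) := by ring
    _ ≤ t * (m - n) + δ * (n / m - 1) := by gcongr
    _ = (m - n) * (t - δ / m) := by field_simp; ring
    _ ≤ 1 * (t - δ / m) := by gcongr
    _ = _ := one_mul _

/-- The number of lattice points in a column is at least the height of the column. -/
lemma sub_div_max_le_card_column (T : ℕ) {δ a : ℝ} (hδ : 0 < δ) (ha : 0 < a) :
    (T : ℝ) - δ / max a (δ / T) ≤
      ((Finset.range T).filter fun j : ℕ => δ ≤ a * ((T : ℝ) - j)).card := by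
  rcases le_total a (δ / T) with h | h
  · rw [max_eq_right h, div_div_cancel₀ hδ.ne', sub_self]
    positivity
  rw [max_eq_left h]
  have hsub : Finset.range ⌈(T : ℝ) - δ / a⌉₊ ⊆
      (Finset.range T).filter fun j : ℕ => δ ≤ a * ((T : ℝ) - j) := by
    intro j hj
    rw [Finset.mem_range, Nat.lt_ceil] at hj
    have hpos : 0 < δ / a := div_pos hδ ha
    rw [Finset.mem_filter, Finset.mem_range, ← div_le_iff₀' ha]
    refine ⟨?_, by linarith⟩
    have : (j : ℝ) < T := by linarith
    exact_mod_cast this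
  have hcard := Finset.card_le_card hsub
  rw [Finset.card_range] at hcard
  exact (Nat.le_ceil _).trans (by exact_mod_cast hcard)


/-- For an integer `T ≥ 1` and a real `δ` with `T ≤ δ ≤ T²`, the number of integer pairs
`(i, j)` with `0 ≤ i, j ≤ T − 1` and `(T − i)(T − j) ≥ δ` is at least
`T² − δ + δ·ln(δ/T²)`. -/
theorem stmt15 (T : ℕ) (hT : 1 ≤ T) (δ : ℝ) (h1 : (T : ℝ) ≤ δ) (h2 : δ ≤ (T : ℝ) ^ 2) :
    (T : ℝ) ^ 2 - δ + δ * Real.log (δ / (T : ℝ) ^ 2) ≤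
      (Nat.card {ij : ℕ × ℕ | ij.1 ≤ T - 1 ∧ ij.2 ≤ T - 1 ∧
        δ ≤ ((T : ℝ) - ij.1) * ((T : ℝ) - ij.2)} : ℝ) := by
  have hT0 : (0 : ℝ) < T := by exact_mod_cast hT
  have hδ : 0 < δ := hT0.trans_le h1
  have hset : {ij : ℕ × ℕ | ij.1 ≤ T - 1 ∧ ij.2 ≤ T - 1 ∧
        δ ≤ ((T : ℝ) - ij.1) * ((T : ℝ) - ij.2)} =
      ((Finset.range T ×ˢ Finset.range T).filter fun ij : ℕ × ℕ =>
        δ ≤ ((T : ℝ) - ij.1) * ((T : ℝ) - ij.2) : Finset (ℕ × ℕ)) := by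
    ext ⟨i, j⟩
    simp only [Set.mem_ofPred_eq, Finset.coe_filter, Finset.mem_product, Finset.mem_range,
      Nat.le_sub_one_iff_lt hT, and_assoc]
  have hcolumns : ((Finset.range T ×ˢ Finset.range T).filter fun ij : ℕ × ℕ =>
        δ ≤ ((T : ℝ) - ij.1) * ((T : ℝ) - ij.2)).card =
      ∑ i ∈ Finset.range T,
        ((Finset.range T).filter fun j : ℕ => δ ≤ ((T : ℝ) - i) * ((T : ℝ) - j)).card := by
    simp only [Finset.card_filter, Finset.sum_product]
  rw [hset, Nat.card_coe_set_eq, Set.ncard_coe_finset, hcolumns, Nat.cast_sum]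
  calc _ = areaAboveHyperbola T δ (T - (0 : ℕ)) - areaAboveHyperbola T δ (T - T) := by
        rw [sub_self, areaAboveHyperbola_zero hT0 hδ, Nat.cast_zero, sub_zero, sub_zero,
          areaAboveHyperbola_self hT0 h2]
    _ = ∑ i ∈ Finset.range T,
        (areaAboveHyperbola T δ (T - i) - areaAboveHyperbola T δ (T - (i + 1 : ℕ))) :=
        (Finset.sum_range_sub' (fun i : ℕ => areaAboveHyperbola T δ (T - i)) T).symm
    _ ≤ _ := by
        refine Finset.sum_le_sum fun i hi => ?_
        have hi' : (i : ℝ) < T := by exact_mod_cast Finset.mem_range.mp hi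
        rw [Nat.cast_add_one, ← sub_sub]
        exact (areaAboveHyperbola_sub_le hT0 hδ _).trans
          (sub_div_max_le_card_column T hδ (sub_pos.mpr hi'))
end
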